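/- Let k be a field of characteristic p > 0 and G a finite group with p dividing |G|. Define the stable Kelly radical on finite-dimensional kG-modules by: a kG-linear map f: M → N lies in StRad(M, N) if and only if for every kG-linear g: N → M the map id_M − g∘f is a stable isomorphism. Then the stable Kelly radical is a tensor ideal (i.e., f ∈ StRad(M, N) implies f ⊗ id_X ∈ StRad(M ⊗ X, N ⊗ X) for every finite-dimensional kG-module X) if and only if p² does not divide |G|. -/

import Mathlib

open TensorProduct

section Defs

variable {k G : Type} [Field k] [Group G]

/-- A `kG`-linear map between two representations of `G` over `k`:
a `k`-linear map commuting with the `G`-actions. -/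
def Equivariant {V W : Type} [AddCommGroup V] [Module k V] [AddCommGroup W] [Module k W]
    (ρV : Representation k G V) (ρW : Representation k G W) (f : V →ₗ[k] W) : Prop :=
  ∀ g : G, f ∘ₗ ρV g = ρW g ∘ₗ f

/-- A `kG`-linear map is stably trivial if it factors through a projective
`kG`-module (equivariantly). -/
def StablyTrivial {V W : Type} [AddCommGroup V] [Module k V] [AddCommGroup W] [Module k W]
    (ρV : Representation k G V) (ρW : Representation k G W) (f : V →ₗ[k] W) : Prop :=
  ∃ (P : Type) (_ : AddCommGroup P) (_ : Module k P) (ρP : Representation k G P),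
    Module.Projective (MonoidAlgebra k G) ρP.asModule ∧
    ∃ (a : V →ₗ[k] P) (b : P →ₗ[k] W),
      Equivariant ρV ρP a ∧ Equivariant ρP ρW b ∧ f = b ∘ₗ a

/-- A `kG`-linear map is a stable isomorphism if it is invertible up to
stably trivial maps. -/
def StableIso {V W : Type} [AddCommGroup V] [Module k V] [AddCommGroup W] [Module k W]
    (ρV : Representation k G V) (ρW : Representation k G W) (f : V →ₗ[k] W) : Prop :=
  Equivariant ρV ρW f ∧ ∃ ψ : W →ₗ[k] V, Equivariant ρW ρV ψ ∧
    StablyTrivial ρV ρV (ψ ∘ₗ f - LinearMap.id) ∧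
    StablyTrivial ρW ρW (f ∘ₗ ψ - LinearMap.id)

end Defs

open Module

section Transfer

variable {k G : Type} [Field k] [Group G]
variable {U V W Z : Type} [AddCommGroup U] [Module k U] [AddCommGroup V] [Module k V]
  [AddCommGroup W] [Module k W] [AddCommGroup Z] [Module k Z]
  {ρU : Representation k G U} {ρV : Representation k G V} {ρW : Representation k G W}
  {ρZ : Representation k G Z}

namespace Equivariant

lemma comp {b : V →ₗ[k] W} {a : U →ₗ[k] V} (hb : Equivariant ρV ρW b)
    (ha : Equivariant ρU ρV a) : Equivariant ρU ρW (b ∘ₗ a) := fun g ↦ by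
  rw [LinearMap.comp_assoc, ha g, ← LinearMap.comp_assoc, hb g, LinearMap.comp_assoc]

lemma id : Equivariant ρV ρV LinearMap.id := fun _ ↦ rfl

lemma sub {a b : V →ₗ[k] W} (ha : Equivariant ρV ρW a) (hb : Equivariant ρV ρW b) :
    Equivariant ρV ρW (a - b) := fun g ↦ by
  rw [LinearMap.sub_comp, LinearMap.comp_sub, ha g, hb g]

lemma add {a b : V →ₗ[k] W} (ha : Equivariant ρV ρW a) (hb : Equivariant ρV ρW b) :
    Equivariant ρV ρW (a + b) := fun g ↦ by
  rw [LinearMap.add_comp, LinearMap.comp_add, ha g, hb g]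

lemma aeval {a : V →ₗ[k] V} (ha : Equivariant ρV ρV a) (q : Polynomial k) :
    Equivariant ρV ρV (Polynomial.aeval (R := k) (A := End k V) a q) := fun g ↦
  (Algebra.commute_of_mem_adjoin_singleton_of_commute (R := k)
    (Polynomial.aeval_mem_adjoin_singleton k a) (show Commute (ρV g) a from (ha g).symm)).symm

lemma rTensor {f : V →ₗ[k] W} (hf : Equivariant ρV ρW f) :
    Equivariant (ρV.tprod ρZ) (ρW.tprod ρZ) (f.rTensor Z) := fun g ↦ by
  rw [Representation.tprod_apply, Representation.tprod_apply]
  ext v z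
  simpa using congr_arg (· ⊗ₜ[k] ρZ g z) (LinearMap.congr_fun (hf g) v)

end Equivariant

variable [Fintype G]

/-- The transfer `∑ g, g h g⁻¹` of a `k`-linear map to an equivariant map. -/
noncomputable def transfer (ρV : Representation k G V) (ρW : Representation k G W)
    (h : V →ₗ[k] W) : V →ₗ[k] W :=
  ∑ g : G, ρW g ∘ₗ h ∘ₗ ρV g⁻¹

lemma transfer_apply (h : V →ₗ[k] W) (v : V) :
    transfer ρV ρW h v = ∑ g : G, ρW g (h (ρV g⁻¹ v)) := by
  simp [transfer]

lemma equivariant_transfer (h : V →ₗ[k] W) : Equivariant ρV ρW (transfer ρV ρW h) := fun x ↦ by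
  ext v
  simp only [LinearMap.comp_apply, transfer_apply, map_sum]
  refine (Fintype.sum_equiv (Equiv.mulLeft x) _ _ fun g ↦ ?_).symm
  simp [map_mul]

lemma Equivariant.comp_transfer {b : V →ₗ[k] W} (hb : Equivariant ρV ρW b) (h : U →ₗ[k] V) :
    b ∘ₗ transfer ρU ρV h = transfer ρU ρW (b ∘ₗ h) := by
  ext v
  simp only [LinearMap.comp_apply, transfer_apply, map_sum]
  exact Finset.sum_congr rfl fun g _ ↦ LinearMap.congr_fun (hb g) _

lemma Equivariant.transfer_comp {a : U →ₗ[k] V} (ha : Equivariant ρU ρV a) (h : V →ₗ[k] W) :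
    transfer ρV ρW h ∘ₗ a = transfer ρU ρW (h ∘ₗ a) := by
  ext v
  simp only [LinearMap.comp_apply, transfer_apply]
  exact Finset.sum_congr rfl fun g _ ↦
    congr_arg (fun u ↦ ρW g (h u)) (LinearMap.congr_fun (ha g⁻¹) v).symm

open MonoidAlgebra in
/-- The identity of a projective module is a transfer. -/
lemma exists_transfer_eq_id_of_projective (ρV : Representation k G V)
    [hV : Projective (MonoidAlgebra k G) ρV.asModule] :
    ∃ h : V →ₗ[k] V, transfer ρV ρV h = LinearMap.id := by
  classical
  obtain ⟨s, hs⟩ := projective_def'.1 hV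
  let E : (ρV.asModule →₀ MonoidAlgebra k G) →ₗ[k] V :=
    Finsupp.lsum k fun x ↦ (LinearMap.toSpanSingleton k V (ρV.asModuleEquiv x)) ∘ₗ
      Finsupp.lapply 1 ∘ₗ (coeffLinearEquiv k (S := k) (M := G)).toLinearMap
  have hE (y : ρV.asModule →₀ MonoidAlgebra k G) :
      ∑ g : G, ρV g (E (of k G g⁻¹ • y)) =
        ρV.asModuleEquiv (Finsupp.linearCombination (MonoidAlgebra k G) _root_.id y) := by
    induction y using Finsupp.induction_linear with
    | zero => simp
    | add a b ha hb => simp only [smul_add, map_add, Finset.sum_add_distrib, ha, hb]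
    | single x r =>
      induction r using MonoidAlgebra.induction_linear with
      | zero => simp
      | add a b ha hb =>
        simp only [Finsupp.single_add, smul_add, map_add, Finset.sum_add_distrib, ha, hb]
      | single a r =>
        simp only [E, Finsupp.smul_single, smul_eq_mul, of_apply, single_mul_single, one_mul,
          Finsupp.lsum_single, LinearMap.comp_apply, LinearEquiv.coe_coe,
          Finsupp.linearCombination_single, Representation.single_smul, id_eq]
        rw [Finset.sum_eq_single a]
        · simp only [inv_mul_cancel, coeffLinearEquiv_apply, coeff_single, Finsupp.lapply_apply,
            Finsupp.single_eq_same, LinearMap.toSpanSingleton_apply, map_smul]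
          rfl
        · simp +contextual [inv_mul_eq_one]
        · simp
  refine ⟨E ∘ₗ (s.restrictScalars k) ∘ₗ ρV.asModuleEquiv.symm.toLinearMap, ?_⟩
  ext v
  rw [transfer_apply, LinearMap.id_apply]
  calc _ = ∑ g : G, ρV g (E (of k G g⁻¹ • s (ρV.asModuleEquiv.symm v))) := by
        refine Finset.sum_congr rfl fun g _ ↦ ?_
        rw [← map_smul, ← Representation.asModuleEquiv_symm_map_rho]
        rfl
    _ = v := by
        rw [hE]
        have := LinearMap.congr_fun hs (ρV.asModuleEquiv.symm v)
        simp only [LinearMap.comp_apply, LinearMap.id_apply] at this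
        rw [this, LinearEquiv.apply_symm_apply]

open MonoidAlgebra in
lemma stablyTrivial_transfer (h : V →ₗ[k] W) :
    StablyTrivial ρV ρW (transfer ρV ρW h) := by
  classical
  let β := Basis.ofVectorSpace k W
  let ι := Basis.ofVectorSpaceIndex k W
  let e : W →ₗ[k] (ι →₀ MonoidAlgebra k G) := β.constr k fun i ↦ .single i (single 1 1)
  let b : (ι →₀ MonoidAlgebra k G) →ₗ[k] W :=
    Finsupp.lsum k fun i ↦ (LinearMap.applyₗ (β i)) ∘ₗ ρW.asAlgebraHom.toLinearMap
  have hb : Equivariant (Representation.free k G ι) ρW b := fun g ↦ by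
    ext i x
    simp [b, map_mul]
  have hbe : b ∘ₗ e = LinearMap.id := β.ext fun i ↦ by simp [b, e]
  have := Representation.free_asModule_free k G ι
  refine ⟨ι →₀ MonoidAlgebra k G, inferInstance, inferInstance, Representation.free k G ι,
    inferInstance, transfer ρV _ (e ∘ₗ h), b, equivariant_transfer _, hb, ?_⟩
  rw [hb.comp_transfer, ← LinearMap.comp_assoc, hbe, LinearMap.id_comp]

/-- Higman's criterion. -/
lemma stablyTrivial_iff_exists_transfer {f : V →ₗ[k] W} :
    StablyTrivial ρV ρW f ↔ ∃ h, f = transfer ρV ρW h := by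
  constructor
  · rintro ⟨P, _, _, ρP, hP, a, b, ha, hb, rfl⟩
    obtain ⟨h, hh⟩ := exists_transfer_eq_id_of_projective ρP
    refine ⟨b ∘ₗ h ∘ₗ a, ?_⟩
    rw [← hb.comp_transfer, ← ha.transfer_comp, hh, LinearMap.id_comp]
  · rintro ⟨h, rfl⟩
    exact stablyTrivial_transfer h

end Transfer

section Fitting

variable {k V : Type} [Field k] [AddCommGroup V] [Module k V] [FiniteDimensional k V]

open Polynomial in
/-- Fitting's lemma: the idempotent projecting onto the part of `V` on which `a` is invertible is
a polynomial multiple of `a`. -/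
lemma exists_fitting_polynomial (a : End k V) : ∃ (c : k[X]) (n : ℕ),
    IsIdempotentElem (aeval a c * a) ∧ a ^ (n + 1) * (1 - aeval a c * a) = 0 := by
  obtain ⟨s, hs, hXs⟩ := exists_eq_pow_rootMultiplicity_mul_and_not_dvd (minpoly k a)
    (minpoly.ne_zero (Algebra.IsIntegral.isIntegral a)) 0
  generalize (minpoly k a).rootMultiplicity 0 = m at hs
  rw [C_0, sub_zero] at hs hXs
  obtain ⟨u, v, huv⟩ : IsCoprime (X ^ (m + 1)) s :=
    ((irreducible_X.coprime_iff_not_dvd).2 hXs).pow_left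
  have hX : aeval a (u * X ^ m) * a = aeval a (u * X ^ (m + 1)) := by
    simp [pow_succ, mul_assoc]
  have h1 : (1 : End k V) - aeval a (u * X ^ m) * a = aeval a (v * s) := by
    rw [hX, ← map_one (aeval (R := k) a), ← map_sub, ← huv, add_sub_cancel_left]
  have h0 : aeval a (X ^ m * s) = 0 := by rw [← hs, minpoly.aeval]
  refine ⟨u * X ^ m, m, ?_, ?_⟩
  · have h : aeval a (u * X ^ m) * a * (1 - aeval a (u * X ^ m) * a) = 0 := by
      rw [h1, hX, ← map_mul,
        show u * X ^ (m + 1) * (v * s) = v * u * X * (X ^ m * s) by ring, map_mul, h0, mul_zero]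
    rw [mul_sub, mul_one, sub_eq_zero] at h
    exact h.symm
  · rw [h1, ← aeval_X_pow (R := k) a, ← map_mul,
      show X ^ (m + 1) * (v * s) = v * X * (X ^ m * s) by ring, map_mul, h0, mul_zero]

end Fitting

section PartialTrace

variable {k : Type} [Field k]
variable {M N X : Type} [AddCommGroup M] [Module k M] [FiniteDimensional k M]
  [AddCommGroup N] [Module k N]
  [AddCommGroup X] [Module k X] [FiniteDimensional k X]

lemma eq_zero_of_forall_trace_comp_eq_zero (g : N →ₗ[k] M)
    (hg : ∀ a : M →ₗ[k] N, LinearMap.trace k M (g ∘ₗ a) = 0) : g = 0 := by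
  ext n
  refine (Module.forall_dual_apply_eq_zero_iff k (g n)).1 fun l ↦ ?_
  rw [← LinearMap.trace_smulRight l (g n), ← hg (l.smulRight n)]
  congr 1
  ext m
  simp

variable [FiniteDimensional k N]

lemma exists_forall_trace_comp_eq (T : Dual k (M →ₗ[k] N)) :
    ∃ g : N →ₗ[k] M, ∀ a : M →ₗ[k] N, LinearMap.trace k M (g ∘ₗ a) = T a := by
  let B : (N →ₗ[k] M) →ₗ[k] Dual k (M →ₗ[k] N) :=
    LinearMap.mk₂ k (fun g a ↦ LinearMap.trace k M (g ∘ₗ a))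
      (fun g g' a ↦ by rw [LinearMap.add_comp, map_add])
      (fun c g a ↦ by rw [LinearMap.smul_comp, map_smul])
      (fun g a a' ↦ by rw [LinearMap.comp_add, map_add])
      (fun c g a ↦ by rw [LinearMap.comp_smul, map_smul])
  have hB : Function.Injective B := (injective_iff_map_eq_zero B).2 fun g hg ↦
    eq_zero_of_forall_trace_comp_eq_zero g fun a ↦ LinearMap.congr_fun hg a
  obtain ⟨g, hg⟩ := (LinearMap.injective_iff_surjective_of_finrank_eq_finrank
    (by simp [Module.finrank_linearMap, mul_comm])).1 hB T
  exact ⟨g, fun a ↦ LinearMap.congr_fun hg a⟩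

variable {G : Type} [Group G] {ρM : Representation k G M} {ρN : Representation k G N}
  {ρX : Representation k G X}

/-- Negligible maps form a tensor ideal. -/
lemma trace_comp_rTensor_eq_zero {f : M →ₗ[k] N}
    (hf : ∀ g : N →ₗ[k] M, Equivariant ρN ρM g → LinearMap.trace k M (g ∘ₗ f) = 0)
    {g : N ⊗[k] X →ₗ[k] M ⊗[k] X} (hg : Equivariant (ρN.tprod ρX) (ρM.tprod ρX) g) :
    LinearMap.trace k (M ⊗[k] X) (g ∘ₗ f.rTensor X) = 0 := by
  obtain ⟨g', hg'⟩ := exists_forall_trace_comp_eq (M := M) (N := N)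
    (LinearMap.trace k (M ⊗[k] X) ∘ₗ LinearMap.llcomp k _ _ _ g ∘ₗ LinearMap.rTensorHom X)
  replace hg' (a : M →ₗ[k] N) : LinearMap.trace k M (g' ∘ₗ a) =
    LinearMap.trace k (M ⊗[k] X) (g ∘ₗ a.rTensor X) := hg' a
  rw [← hg']
  refine hf g' fun x ↦ ?_
  rw [← sub_eq_zero]
  refine eq_zero_of_forall_trace_comp_eq_zero _ fun a ↦ ?_
  have hXX : ρX x ∘ₗ ρX x⁻¹ = LinearMap.id := by ext; simp
  have hXX' : ρX x⁻¹ ∘ₗ ρX x = LinearMap.id := by ext; simp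
  have h1 : (ρN x ∘ₗ a).rTensor X = ρN.tprod ρX x ∘ₗ TensorProduct.map a (ρX x⁻¹) := by
    rw [Representation.tprod_apply, ← TensorProduct.map_comp, hXX]; rfl
  have h2 : (a ∘ₗ ρM x).rTensor X = TensorProduct.map a (ρX x⁻¹) ∘ₗ ρM.tprod ρX x := by
    rw [Representation.tprod_apply, ← TensorProduct.map_comp, hXX']; rfl
  rw [LinearMap.sub_comp, map_sub, sub_eq_zero, LinearMap.comp_assoc, LinearMap.comp_assoc,
    LinearMap.trace_comp_comm' _ (ρM x), LinearMap.comp_assoc, hg', hg', h1, h2,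
    ← LinearMap.comp_assoc, hg x, LinearMap.trace_comp_comm', ← LinearMap.comp_assoc]
  exact LinearMap.trace_comp_comm' g (TensorProduct.map a (ρX x⁻¹) ∘ₗ ρM.tprod ρX x)

end PartialTrace

section Radical

variable {k G : Type} [Field k] [Group G] [Fintype G]
variable {M : Type} [AddCommGroup M] [Module k M] [FiniteDimensional k M]
  {ρM : Representation k G M}

lemma trace_transfer (hG : (Fintype.card G : k) = 0) (h : M →ₗ[k] M) :
    LinearMap.trace k M (transfer ρM ρM h) = 0 := by
  have (g : G) : LinearMap.trace k M (ρM g ∘ₗ h ∘ₗ ρM g⁻¹) = LinearMap.trace k M h := by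
    rw [LinearMap.trace_comp_comm', LinearMap.comp_assoc, ← Module.End.mul_eq_comp (ρM g⁻¹),
      ← map_mul, inv_mul_cancel, map_one, Module.End.one_eq_id, LinearMap.comp_id]
  simp [transfer, this, hG]

/-- Maps in the stable radical are negligible. -/
lemma trace_eq_zero_of_stableIso (hG : (Fintype.card G : k) = 0) {a : M →ₗ[k] M}
    (ha : Equivariant ρM ρM a)
    (h : ∀ b : M →ₗ[k] M, Equivariant ρM ρM b → StableIso ρM ρM (LinearMap.id - b ∘ₗ a)) :
    LinearMap.trace k M a = 0 := by
  obtain ⟨c, n, he, hn0⟩ := exists_fitting_polynomial a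
  obtain ⟨-, ψ, hψ, h1, -⟩ := h _ (ha.aeval c)
  obtain ⟨t, ht⟩ := stablyTrivial_iff_exists_transfer.1 h1
  have hca : Commute a (Polynomial.aeval a c) :=
    Algebra.commute_of_mem_adjoin_self (Polynomial.aeval_mem_adjoin_singleton k a)
  have hee := (ha.aeval c).comp ha
  rw [← Module.End.mul_eq_comp] at ht hee
  set e := Polynomial.aeval a c * a with he'
  have hae : Commute a e := hca.mul_right (.refl a)
  have h2 : a * e = -transfer ρM ρM (a ∘ₗ t ∘ₗ e) := by
    have : transfer ρM ρM t * e = -e := by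
      rw [← ht, ← Module.End.one_eq_id, sub_mul, mul_assoc, ← Module.End.mul_eq_comp, ← he',
        he.one_sub_mul_self, mul_zero, one_mul, zero_sub]
    rw [← ha.comp_transfer, ← hee.transfer_comp, ← Module.End.mul_eq_comp,
      ← Module.End.mul_eq_comp, this, mul_neg, neg_neg]
  have h3 : IsNilpotent (a * (1 - e)) := ⟨n + 1, by
    rw [((Commute.one_right a).sub_right hae).mul_pow, he.one_sub.pow_succ_eq, hn0]⟩
  rw [show a = a * e + a * (1 - e) by rw [mul_sub, mul_one, add_sub_cancel], map_add, h2,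
    map_neg, trace_transfer hG, neg_zero, zero_add]
  exact (LinearMap.isNilpotent_trace_of_isNilpotent h3).eq_zero

/-- Negligible endomorphisms lie in the stable radical, provided modules all of whose endomorphisms
have trace zero are projective. -/
lemma stableIso_id_sub_of_trace
    (hH : ∀ (V : Type) [AddCommGroup V] [Module k V] [FiniteDimensional k V]
      (ρ : Representation k G V),
      (∀ h : V →ₗ[k] V, Equivariant ρ ρ h → LinearMap.trace k V h = 0) →
      ∃ t, transfer ρ ρ t = LinearMap.id)
    {a : M →ₗ[k] M} (ha : Equivariant ρM ρM a)
    (htr : ∀ b : M →ₗ[k] M, Equivariant ρM ρM b → LinearMap.trace k M (b ∘ₗ a) = 0) :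
    StableIso ρM ρM (LinearMap.id - a) := by
  obtain ⟨e, rfl⟩ : ∃ e, a = 1 - e := ⟨1 - a, (sub_sub_cancel 1 a).symm⟩
  have he : Equivariant ρM ρM e := by
    simpa [← Module.End.one_eq_id] using Equivariant.id.sub ha
  obtain ⟨c, n, hi, hn0⟩ := exists_fitting_polynomial e
  have hca : Commute e (Polynomial.aeval e c) :=
    Algebra.commute_of_mem_adjoin_self (Polynomial.aeval_mem_adjoin_singleton k e)
  have hpi : Equivariant ρM ρM (1 - Polynomial.aeval e c * e) :=
    Equivariant.id.sub ((he.aeval c).comp he)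
  set π : M →ₗ[k] M := 1 - Polynomial.aeval e c * e with hπ
  have hππ : π * π = π := hi.one_sub
  let V := LinearMap.range π
  let ι : V →ₗ[k] M := V.subtype
  let q : M →ₗ[k] V := π.rangeRestrict
  have hιq : ι ∘ₗ q = π := rfl
  have hqι : q ∘ₗ ι = LinearMap.id := by
    ext ⟨_, v, rfl⟩
    exact LinearMap.congr_fun hππ v
  have hπι : π ∘ₗ ι = ι := by rw [← hιq, LinearMap.comp_assoc, hqι, LinearMap.comp_id]
  have hqπ : q ∘ₗ π = q := by rw [← hιq, ← LinearMap.comp_assoc, hqι, LinearMap.id_comp]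
  let ρV : Representation k G V :=
    { toFun g := q ∘ₗ ρM g ∘ₗ ι
      map_one' := by simpa [Module.End.one_eq_id] using hqι
      map_mul' g h := by
        rw [map_mul, Module.End.mul_eq_comp, Module.End.mul_eq_comp]
        calc _ = (q ∘ₗ π) ∘ₗ ρM g ∘ₗ ρM h ∘ₗ ι := by rw [hqπ]; rfl
          _ = q ∘ₗ (π ∘ₗ ρM g) ∘ₗ ρM h ∘ₗ ι := rfl
          _ = _ := by rw [hpi g, ← hιq]; rfl }
  have hι : Equivariant ρV ρM ι := fun g ↦ by
    calc _ = (π ∘ₗ ρM g) ∘ₗ ι := rfl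
      _ = _ := by rw [hpi g, LinearMap.comp_assoc, hπι]
  have hq : Equivariant ρM ρV q := fun g ↦ by
    calc _ = (q ∘ₗ π) ∘ₗ ρM g := by rw [hqπ]
      _ = q ∘ₗ (π ∘ₗ ρM g) := rfl
      _ = _ := by rw [hpi g]; rfl
  obtain ⟨b, hb, hbι⟩ : ∃ b : M →ₗ[k] M, Equivariant ρM ρM b ∧ b ∘ₗ (1 - e) ∘ₗ ι = ι := by
    refine ⟨∑ i ∈ Finset.range (n + 1), e ^ i, ?_, ?_⟩
    · have := he.aeval (∑ i ∈ Finset.range (n + 1), Polynomial.X ^ i)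
      simpa using this
    · rw [← LinearMap.comp_assoc, ← Module.End.mul_eq_comp, geom_sum_mul_neg, ← hπι,
        ← LinearMap.comp_assoc, ← Module.End.mul_eq_comp, sub_mul, hn0, one_mul, sub_zero]
  obtain ⟨t, ht⟩ := hH V ρV fun h hh ↦ by
    have := htr _ ((hι.comp (hh.comp hq)).comp hb)
    rw [LinearMap.comp_assoc, LinearMap.comp_assoc, LinearMap.trace_comp_comm'] at this
    simp only [LinearMap.comp_assoc] at this
    rwa [hbι, hqι, LinearMap.comp_id] at this
  have hπt : π = transfer ρM ρM (ι ∘ₗ t ∘ₗ q) := by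
    rw [← hι.comp_transfer, ← hq.transfer_comp, ht, LinearMap.id_comp, hιq]
  have hst : StablyTrivial ρM ρM (-π) := by
    refine stablyTrivial_iff_exists_transfer.2 ⟨-(ι ∘ₗ t ∘ₗ q), ?_⟩
    rw [hπt]
    ext
    simp [transfer_apply]
  rw [← Module.End.one_eq_id, sub_sub_cancel]
  refine ⟨he, Polynomial.aeval e c, he.aeval c, ?_, ?_⟩
  · rwa [← Module.End.mul_eq_comp, ← Module.End.one_eq_id, ← neg_sub]
  · rwa [← Module.End.mul_eq_comp, ← Module.End.one_eq_id, ← neg_sub, hca.eq]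

end Radical

section Cyclic

variable {k G : Type} [Field k] [Group G] [Fintype G]
variable {V : Type} [AddCommGroup V] [Module k V]

/-- If every endomorphism commuting with `u` has trace zero, then the kernel of `u` is contained in
the range of `u ^ (p - 1)`. -/
lemma ker_le_range_pow_of_trace [FiniteDimensional k V] {p : ℕ} [CharP k p] (u : End k V)
    (htr : ∀ h : End k V, Commute h u → LinearMap.trace k V h = 0) :
    LinearMap.ker u ≤ LinearMap.range (u ^ (p - 1)) := by
  classical
  intro v hv
  by_contra hvp
  have hex : ∃ i, v ∉ LinearMap.range (u ^ i) := ⟨_, hvp⟩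
  obtain ⟨n, hn⟩ : ∃ n, Nat.find hex = n + 1 := Nat.exists_eq_succ_of_ne_zero fun h0 ↦ by
    refine (Nat.find_eq_zero hex).1 h0 ⟨v, ?_⟩
    rw [pow_zero, Module.End.one_apply]
  have hvn : v ∉ LinearMap.range (u ^ (n + 1)) := hn ▸ Nat.find_spec hex
  have hnp : n + 1 ≤ p - 1 := hn ▸ Nat.find_min' hex hvp
  obtain ⟨w, hw⟩ : v ∈ LinearMap.range (u ^ n) :=
    not_not.1 (Nat.find_min hex (by rw [hn]; exact n.lt_succ_self))
  obtain ⟨l, hlv, hl⟩ := Submodule.exists_dual_map_eq_bot_of_notMem hvn inferInstance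
  have hl' (m : V) : l ((u ^ (n + 1)) m) = 0 := by
    rw [← Submodule.mem_bot k, ← hl]
    exact Submodule.mem_map_of_mem ⟨m, rfl⟩
  have hw' : (u ^ (n + 1)) w = 0 := by
    rw [pow_succ', Module.End.mul_apply, hw]
    exact hv
  let h : End k V := ∑ j ∈ Finset.range (n + 1), (l ∘ₗ u ^ (n - j)).smulRight ((u ^ j) w)
  have hh (m : V) : h m = ∑ j ∈ Finset.range (n + 1), l ((u ^ (n - j)) m) • (u ^ j) w := by
    simp [h]
  have hcomm : Commute h u := by
    ext m
    rw [Module.End.mul_apply, Module.End.mul_apply, hh, hh, map_sum]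
    simp only [map_smul, ← Module.End.mul_apply, ← pow_succ', ← pow_succ]
    rw [Finset.sum_range_succ', Finset.sum_range_succ _ n]
    simp only [tsub_zero, hl', zero_smul, hw', smul_zero, add_zero]
    refine Finset.sum_congr rfl fun j hj ↦ ?_
    rw [Finset.mem_range] at hj
    rw [show n - (j + 1) + 1 = n - j by omega]
  have := htr h hcomm
  have hsum : LinearMap.trace k V h = (n + 1 : ℕ) * l v := by
    simp only [h, map_sum, LinearMap.trace_smulRight, LinearMap.comp_apply]
    rw [Finset.sum_congr rfl fun j hj ↦ ?_, Finset.sum_const, Finset.card_range, nsmul_eq_mul]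
    rw [← Module.End.mul_apply, ← pow_add, Nat.sub_add_cancel (by simpa [Nat.lt_succ_iff] using hj),
      hw]
  rw [hsum, mul_eq_zero, or_iff_left hlv, CharP.cast_eq_zero_iff k p] at this
  have := Nat.le_of_dvd n.succ_pos this
  omega

lemma exists_apply_eq_of_mem_range {W : Type} [AddCommGroup W] [Module k W] (N : V →ₗ[k] W) :
    ∃ t : W →ₗ[k] V, ∀ y ∈ LinearMap.range N, N (t y) = y := by
  obtain ⟨s, hs⟩ := N.rangeRestrict.exists_rightInverse_of_surjective N.range_rangeRestrict
  obtain ⟨t, ht⟩ := s.exists_extend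
  refine ⟨t, fun y hy ↦ ?_⟩
  have h1 : t y = s ⟨y, hy⟩ := LinearMap.congr_fun ht ⟨y, hy⟩
  rw [h1]
  exact congr_arg Subtype.val (LinearMap.congr_fun hs ⟨y, hy⟩)

open Polynomial in
lemma geom_sum_X_eq_sub_one_pow {p : ℕ} [Fact p.Prime] [CharP k p] :
    ∑ i ∈ Finset.range p, (X : k[X]) ^ i = (X - 1) ^ (p - 1) := by
  refine mul_right_cancel₀ (X_sub_C_ne_zero (1 : k)) ?_
  rw [map_one, geom_sum_mul, ← pow_succ, Nat.sub_add_cancel (Fact.out : p.Prime).one_le,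
    sub_pow_char, one_pow]

/-- A representation of a cyclic group of order `p` all of whose endomorphisms have trace zero is
projective. -/
lemma exists_transfer_eq_id_of_card_eq_prime [FiniteDimensional k V] {p : ℕ} [Fact p.Prime]
    [CharP k p] (hG : Fintype.card G = p) (ρ : Representation k G V)
    (htr : ∀ h : V →ₗ[k] V, Equivariant ρ ρ h → LinearMap.trace k V h = 0) :
    ∃ t, transfer ρ ρ t = LinearMap.id := by
  classical
  have hG' : Nat.card G = p := by rw [Nat.card_eq_fintype_card, hG]
  have := isCyclic_of_prime_card hG'
  obtain ⟨σ, hσ⟩ := IsCyclic.exists_generator (α := G)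
  have hpow (x : G) : ∃ n : ℕ, σ ^ n = x := (mem_powers_iff_mem_zpowers.2 (hσ x))
  have hord : orderOf σ = p := by rw [orderOf_eq_card_of_forall_mem_zpowers hσ, hG']
  let u : End k V := ρ σ - 1
  have hN : ρ.norm = u ^ (p - 1) := by
    have h1 := congr_arg (Polynomial.aeval (ρ σ)) (geom_sum_X_eq_sub_one_pow (k := k) (p := p))
    simp only [map_sum, map_pow, Polynomial.aeval_X, map_sub, map_one] at h1
    rw [← h1, Representation.norm, ← IsCyclic.image_range_card hσ, hG', Finset.sum_image]
    · simp
    · rw [Finset.coe_range, ← hord]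
      exact pow_injOn_Iio_orderOf
  have hu : u ^ p = 0 := by
    have h1 := congr_arg (Polynomial.aeval (ρ σ))
      (sub_pow_char (p := p) (Polynomial.X : Polynomial k) 1)
    simp only [map_pow, Polynomial.aeval_X, map_sub, map_one, one_pow] at h1
    rw [h1, ← map_pow, ← hord, pow_orderOf_eq_one, map_one, sub_self]
  have hinv {v : V} (hv : u v = 0) (x : G) : ρ x v = v := by
    obtain ⟨n, rfl⟩ := hpow x
    induction n with
    | zero => simp
    | succ n ih =>
      rw [pow_succ, map_mul, Module.End.mul_apply, sub_eq_zero.1 hv]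
      exact ih
  have hker := ker_le_range_pow_of_trace (p := p) u fun h hh ↦ htr h fun x ↦ by
    obtain ⟨n, rfl⟩ := hpow x
    have h1 : Commute h (ρ σ) := by
      have := hh.add_right (Commute.one_right h)
      rwa [sub_add_cancel] at this
    rw [map_pow]
    exact (h1.pow_right n).eq
  obtain ⟨t, ht⟩ := exists_apply_eq_of_mem_range ρ.norm
  set h := transfer ρ ρ t with hh
  have hfix {v : V} (hv : u v = 0) : h v = v := by
    rw [hh, transfer_apply]
    simp only [hinv hv]
    have := ht v (hN ▸ hker hv)
    rwa [Representation.norm, LinearMap.sum_apply] at this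
  have heq : Equivariant ρ ρ h := equivariant_transfer t
  have hhu (v : V) : h (u v) = u (h v) := by
    have := LinearMap.congr_fun (heq σ) v
    simp only [LinearMap.comp_apply] at this
    simp [u, this]
  have hinj (n : ℕ) : ∀ v, (u ^ n) v = 0 → h v = 0 → v = 0 := by
    induction n with
    | zero => intro v hv _; simpa using hv
    | succ n ih =>
      intro v hv hv'
      have huv : u v = 0 := ih _ (by rwa [pow_succ] at hv) (by rw [hhu, hv', map_zero])
      rw [← hfix huv, hv']
  let e := LinearEquiv.ofInjectiveEndo h
    ((injective_iff_map_eq_zero h).2 fun v hv ↦ hinj p v (by rw [hu]; rfl) hv)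
  have he (v : V) : h (e.symm v) = v := e.apply_symm_apply v
  have hes : Equivariant ρ ρ e.symm.toLinearMap := fun x ↦ by
    ext v
    refine e.injective ?_
    have := LinearMap.congr_fun (heq x) (e.symm v)
    simp only [LinearMap.comp_apply, he] at this
    exact (he _).trans this.symm
  refine ⟨e.symm.toLinearMap ∘ₗ t, ?_⟩
  rw [← hes.comp_transfer]
  ext v
  exact e.symm_apply_apply v

end Cyclic

section Index

variable {k G : Type} [Field k] [Group G] [Fintype G] (Q : Subgroup G) [Fintype Q]
  [Fintype (G ⧸ Q)]

lemma sum_eq_sum_quotient_out_mul {A : Type} [AddCommMonoid A] (F : G → A) :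
    ∑ g, F g = ∑ q : G ⧸ Q, ∑ x : Q, F (q.out * x) := by
  rw [← Fintype.sum_prod_type']
  symm
  refine Fintype.sum_bijective (fun y : (G ⧸ Q) × Q ↦ y.1.out * y.2) ⟨?_, fun g ↦ ?_⟩ _ _
    fun _ ↦ rfl
  · rintro ⟨q, x⟩ ⟨q', x'⟩ h
    have hq : q = q' := by
      have := congr_arg (QuotientGroup.mk : G → G ⧸ Q) h
      simpa using this
    subst hq
    simpa using h
  · refine ⟨⟨g, ⟨(g : G ⧸ Q).out⁻¹ * g, QuotientGroup.eq.1 (Quotient.out_eq' _)⟩⟩, ?_⟩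
    simp

variable {V : Type} [AddCommGroup V] [Module k V]

/-- Relative projectivity with respect to a subgroup of invertible index. -/
lemma exists_transfer_eq_id_of_subgroup (hQ : (Fintype.card (G ⧸ Q) : k) ≠ 0)
    (ρ : Representation k G V)
    (hH : (∀ h : V →ₗ[k] V, Equivariant (ρ.comp Q.subtype) (ρ.comp Q.subtype) h →
      LinearMap.trace k V h = 0) →
      ∃ t, transfer (ρ.comp Q.subtype) (ρ.comp Q.subtype) t = LinearMap.id)
    (htr : ∀ h : V →ₗ[k] V, Equivariant ρ ρ h → LinearMap.trace k V h = 0) :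
    ∃ t, transfer ρ ρ t = LinearMap.id := by
  have hinv (g : G) : ρ g * ρ g⁻¹ = 1 := by rw [← map_mul, mul_inv_cancel, map_one]
  have hinv' (g : G) : ρ g⁻¹ * ρ g = 1 := by rw [← map_mul, inv_mul_cancel, map_one]
  obtain ⟨t, ht⟩ := hH fun h hh ↦ by
    let F (g : G) : End k V := ρ g * h * ρ g⁻¹
    have hF (g : G) (x : Q) : F (g * x) = F g := by
      have h1 : h * ρ x = ρ x * h := hh x
      simp only [F, mul_inv_rev, map_mul]
      rw [mul_assoc (ρ g), ← h1, ← mul_assoc, ← mul_assoc, mul_assoc _ (ρ (x : G)), hinv, mul_one]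
    have hF' (g : G) : F (g : G ⧸ Q).out = F g := by
      obtain ⟨x, hx⟩ := QuotientGroup.mk_out_eq_mul Q g
      rw [hx, hF]
    have hsum : Equivariant ρ ρ (∑ q : G ⧸ Q, F q.out) := fun g ↦ by
      change (∑ q : G ⧸ Q, F q.out) * ρ g = ρ g * ∑ q : G ⧸ Q, F q.out
      rw [Finset.sum_mul, Finset.mul_sum]
      symm
      refine Fintype.sum_equiv (MulAction.toPerm g) _ _ fun q ↦ ?_
      have h1 : F (g • q).out = F (g * q.out) := by
        rw [← hF' (g * q.out), ← smul_eq_mul, ← MulAction.Quotient.smul_coe,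
          QuotientGroup.out_eq']
      rw [MulAction.toPerm_apply, h1]
      simp only [F, mul_inv_rev, map_mul, mul_assoc, hinv', mul_one]
    have := htr _ hsum
    have hFtr (g : G) : LinearMap.trace k V (F g) = LinearMap.trace k V h := by
      rw [LinearMap.trace_mul_comm, ← mul_assoc, hinv', one_mul]
    simp only [map_sum, hFtr, Finset.sum_const, Finset.card_univ, nsmul_eq_mul] at this
    exact (mul_eq_zero.1 this).resolve_left hQ
  refine ⟨(Fintype.card (G ⧸ Q) : k)⁻¹ • t, ?_⟩
  have key : transfer ρ ρ t = (Fintype.card (G ⧸ Q) : k) • LinearMap.id := by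
    rw [transfer, sum_eq_sum_quotient_out_mul Q]
    have (q : G ⧸ Q) : ∑ x : Q, ρ (q.out * x) ∘ₗ t ∘ₗ ρ (q.out * x)⁻¹ = LinearMap.id := by
      have h1 : (∑ x : Q, ρ x * (t * ρ (x : G)⁻¹)) = 1 := ht
      change ∑ x : Q, ρ (q.out * x) * (t * ρ (q.out * x)⁻¹) = 1
      simp only [mul_inv_rev, map_mul]
      calc _ = ρ q.out * (∑ x : Q, ρ x * (t * ρ (x : G)⁻¹)) * ρ q.out⁻¹ := by
            simp only [Finset.mul_sum, Finset.sum_mul, mul_assoc]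
        _ = 1 := by rw [h1, mul_one, hinv]
    simp only [this, Finset.sum_const, Finset.card_univ, Nat.cast_smul_eq_nsmul]
  ext v
  have := LinearMap.congr_fun key v
  rw [transfer_apply] at this ⊢
  simp only [LinearMap.smul_apply, map_smul, ← Finset.smul_sum, this, LinearMap.id_apply]
  rw [smul_smul, inv_mul_cancel₀ hQ, one_smul]

end Index

section Splitting

variable {k G : Type} [Field k] [Group G] [Fintype G]
variable {V W : Type} [AddCommGroup V] [Module k V] [AddCommGroup W] [Module k W]
  {ρV : Representation k G V} {ρW : Representation k G W}

lemma stableIso_id_sub_comp_of_comp_eq_zero {a : V →ₗ[k] W} {b : W →ₗ[k] V}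
    (ha : Equivariant ρV ρW a) (hb : Equivariant ρW ρV b) (hab : a ∘ₗ b = 0) :
    StableIso ρV ρV (LinearMap.id - b ∘ₗ a) := by
  have h0 : StablyTrivial ρV ρV 0 :=
    stablyTrivial_iff_exists_transfer.2 ⟨0, by ext; simp [transfer_apply]⟩
  have h (v : V) : a (b (a v)) = 0 := LinearMap.congr_fun hab _
  have hid : (LinearMap.id + b ∘ₗ a) ∘ₗ (LinearMap.id - b ∘ₗ a) - LinearMap.id = 0 := by
    ext v
    simp [h]
  have hid' : (LinearMap.id - b ∘ₗ a) ∘ₗ (LinearMap.id + b ∘ₗ a) - LinearMap.id = 0 := by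
    ext v
    simp [h]
  exact ⟨Equivariant.id.sub (hb.comp ha), LinearMap.id + b ∘ₗ a, Equivariant.id.add (hb.comp ha),
    by rwa [hid], by rwa [hid']⟩

/-- If the complement of a direct summand is stably the whole module, then the summand is
projective. -/
lemma exists_transfer_eq_id_of_stableIso {F : W →ₗ[k] V} {g : V →ₗ[k] W}
    (hF : Equivariant ρW ρV F) (hg : Equivariant ρV ρW g) (hFg : F ∘ₗ g = LinearMap.id)
    (h : StableIso ρW ρW (LinearMap.id - g ∘ₗ F)) :
    ∃ t, transfer ρV ρV t = LinearMap.id := by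
  obtain ⟨-, ψ, -, hψ, -⟩ := h
  obtain ⟨t, ht⟩ := stablyTrivial_iff_exists_transfer.1 hψ
  have hFg' (v : V) : F (g v) = v := LinearMap.congr_fun hFg v
  refine ⟨F ∘ₗ (-t) ∘ₗ g, ?_⟩
  have hneg : transfer ρW ρW (-t) = -transfer ρW ρW t := by
    ext
    simp [transfer_apply]
  rw [← hF.comp_transfer, ← hg.transfer_comp, hneg, ← ht]
  ext v
  simp [hFg']

end Splitting

section Permutation

variable (k G : Type) [Field k] [Group G] (A : Type) [MulAction G A]

/-- The permutation representation on the functions on a `G`-set. -/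
def funRep : Representation k G (A → k) where
  toFun x := LinearMap.funLeft k k (x⁻¹ • · : A → A)
  map_one' := by ext; simp [LinearMap.funLeft]
  map_mul' x y := by ext; simp [LinearMap.funLeft, mul_smul]

variable {k G A}

lemma funRep_apply (x : G) (f : A → k) (a : A) : funRep k G A x f a = f (x⁻¹ • a) := rfl

lemma funRep_single [DecidableEq A] (x : G) (a : A) (r : k) :
    funRep k G A x (Pi.single a r) = Pi.single (x • a) r := by
  ext b
  simp [funRep_apply, Pi.single_apply, inv_smul_eq_iff]

variable (k A) [Fintype A]

/-- The sum over the diagonal. -/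
def diagSum : (A × A → k) →ₗ[k] k := ∑ a : A, LinearMap.proj (a, a)

variable {k A}

lemma diagSum_apply (m : A × A → k) : diagSum k A m = ∑ a : A, m (a, a) := by
  simp [diagSum]

lemma equivariant_diagSum :
    Equivariant (funRep k G (A × A)) (Representation.trivial k G k) (diagSum k A) := fun x ↦ by
  refine LinearMap.ext fun m ↦ ?_
  simp only [LinearMap.comp_apply, diagSum_apply, funRep_apply, Prod.smul_mk,
    Representation.isTrivial_def, LinearMap.id_apply]
  exact Fintype.sum_equiv (MulAction.toPerm x⁻¹) _ _ fun _ ↦ rfl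

lemma diagSum_comp_eq_zero [MulAction.IsPretransitive G A] (hA : (Fintype.card A : k) = 0)
    {γ : k →ₗ[k] A × A → k}
    (hγ : Equivariant (Representation.trivial k G k) (funRep k G (A × A)) γ) :
    diagSum k A ∘ₗ γ = 0 := by
  refine LinearMap.ext fun r ↦ ?_
  have h (x : G) (a : A) : γ r (x⁻¹ • a, x⁻¹ • a) = γ r (a, a) :=
    (congr_fun (LinearMap.congr_fun (hγ x) r) (a, a)).symm
  rw [LinearMap.comp_apply, diagSum_apply, LinearMap.zero_apply]
  rcases isEmpty_or_nonempty A with _ | ⟨⟨a₀⟩⟩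
  · simp
  · have (a : A) : γ r (a, a) = γ r (a₀, a₀) := by
      obtain ⟨x, rfl⟩ := MulAction.exists_smul_eq G a a₀
      simpa using (h x (x • a))
    simp [this, hA]

variable (k A) [DecidableEq A]

/-- The coevaluation of the functions on a finite set. -/
noncomputable def funCoev : (A → k) →ₗ[k] (A × A → k) ⊗[k] (A → k) :=
  ∑ b : A, (TensorProduct.mk k (A × A → k) (A → k)).flip (Pi.single b 1) ∘ₗ
    LinearMap.pi fun y ↦ (Pi.single b 1 : A → k) y.2 • LinearMap.proj y.1

variable {k A}

lemma funCoev_apply (f : A → k) :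
    funCoev k A f = ∑ b : A, (fun y : A × A ↦ (Pi.single b 1 : A → k) y.2 * f y.1) ⊗ₜ[k]
      (Pi.single b 1 : A → k) := by
  simp only [funCoev, LinearMap.sum_apply, LinearMap.comp_apply, LinearMap.flip_apply,
    TensorProduct.mk_apply]
  rfl

lemma equivariant_funCoev :
    Equivariant (funRep k G A) ((funRep k G (A × A)).tprod (funRep k G A)) (funCoev k A) := fun x ↦ by
  refine LinearMap.ext fun f ↦ ?_
  simp only [LinearMap.comp_apply, funCoev_apply, map_sum, Representation.tprod_apply,
    TensorProduct.map_tmul, funRep_single]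
  refine (Fintype.sum_equiv (MulAction.toPerm (α := G) (β := A) x) _ _ fun b ↦ ?_).symm
  congr 1
  ext y
  simp [funRep_apply, Pi.single_apply, inv_smul_eq_iff]

lemma lid_diagSum_funCoev :
    ((TensorProduct.lid k (A → k)).toLinearMap ∘ₗ (diagSum k A).rTensor (A → k)) ∘ₗ funCoev k A =
      LinearMap.id := by
  refine LinearMap.ext fun f ↦ ?_
  simp only [LinearMap.comp_apply, funCoev_apply, map_sum, LinearMap.rTensor_tmul, diagSum_apply]
  ext a
  simp [Pi.single_apply]

lemma equivariant_lid {V : Type} [AddCommGroup V] [Module k V] (ρ : Representation k G V) :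
    Equivariant ((Representation.trivial k G k).tprod ρ) ρ
      (TensorProduct.lid k V).toLinearMap := fun x ↦ by
  rw [Representation.tprod_apply]
  ext
  simp

end Permutation

section Main

variable {k G : Type} [Field k] [Group G] [Fintype G] {p : ℕ} [Fact p.Prime] [CharP k p]

/-- The permutation module on the cosets of a subgroup whose order vanishes in `k` is not
projective. -/
lemma transfer_funRep_quotient_ne_id {Q : Subgroup G} [Fintype Q] (hQ : (Fintype.card Q : k) = 0)
    (t : (G ⧸ Q → k) →ₗ[k] G ⧸ Q → k) :
    transfer (funRep k G (G ⧸ Q)) (funRep k G (G ⧸ Q)) t ≠ LinearMap.id := by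
  classical
  have : Fintype (G ⧸ Q) := Fintype.ofFinite _
  intro h
  have h1 := congr_fun (LinearMap.congr_fun h (Pi.single ((1 : G) : G ⧸ Q) 1)) ((1 : G) : G ⧸ Q)
  simp only [transfer_apply, funRep_single, Finset.sum_apply, funRep_apply, LinearMap.id_apply,
    Pi.single_eq_same] at h1
  rw [Fintype.sum_equiv (Equiv.inv G)
    (fun g ↦ t (Pi.single (g⁻¹ • ((1 : G) : G ⧸ Q)) 1) (g⁻¹ • ((1 : G) : G ⧸ Q)))
    (fun g ↦ t (Pi.single (g • ((1 : G) : G ⧸ Q)) 1) (g • ((1 : G) : G ⧸ Q))) fun _ ↦ rfl,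
    sum_eq_sum_quotient_out_mul Q] at h1
  have hx (g : G) (x : Q) : (g * x) • ((1 : G) : G ⧸ Q) = g • ((1 : G) : G ⧸ Q) := by
    rw [mul_smul]
    congr 1
    rw [MulAction.Quotient.smul_coe, smul_eq_mul, mul_one, QuotientGroup.eq, mul_one]
    exact inv_mem x.2
  simp [hx, hQ] at h1

lemma exists_subgroup_card_eq (hG : p ∣ Fintype.card G) :
    ∃ Q : Subgroup G, Nat.card Q = p := by
  obtain ⟨σ, hσ⟩ := exists_prime_orderOf_dvd_card p hG
  exact ⟨Subgroup.zpowers σ, by rw [Nat.card_zpowers, hσ]⟩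

lemma exists_transfer_eq_id_of_sq_not_dvd (hG : p ∣ Fintype.card G)
    (hp : ¬ p ^ 2 ∣ Fintype.card G) {V : Type} [AddCommGroup V] [Module k V]
    [FiniteDimensional k V] (ρ : Representation k G V)
    (htr : ∀ h : V →ₗ[k] V, Equivariant ρ ρ h → LinearMap.trace k V h = 0) :
    ∃ t, transfer ρ ρ t = LinearMap.id := by
  classical
  obtain ⟨Q, hQ⟩ := exists_subgroup_card_eq hG
  have : Fintype (G ⧸ Q) := Fintype.ofFinite _
  refine exists_transfer_eq_id_of_subgroup Q (fun h ↦ hp ?_) ρ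
    (exists_transfer_eq_id_of_card_eq_prime (by rw [← Nat.card_eq_fintype_card, hQ]) _) htr
  rw [CharP.cast_eq_zero_iff k p, ← Nat.card_eq_fintype_card] at h
  rw [← Nat.card_eq_fintype_card, Q.card_eq_card_quotient_mul_card_subgroup, hQ, pow_two]
  exact mul_dvd_mul_right h p

end Main

/-- The Kelly radical of the stable module category of `kG` (where
`f ∈ StRad(M, N)` iff `id - g ∘ f` is a stable isomorphism for every `g`) is a tensor
ideal if and only if `p²` does not divide `|G|`. -/
theorem stable_kelly_radical_is_tensor_ideal_iff_p_squared_not_dvd_order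
    (p : ℕ) (hp : p.Prime) (k : Type) [Field k] [CharP k p]
    (G : Type) [Group G] [Fintype G] (hG : p ∣ Fintype.card G) :
    (∀ (M N X : Type)
      [AddCommGroup M] [Module k M] [FiniteDimensional k M]
      [AddCommGroup N] [Module k N] [FiniteDimensional k N]
      [AddCommGroup X] [Module k X] [FiniteDimensional k X]
      (ρM : Representation k G M) (ρN : Representation k G N)
      (ρX : Representation k G X) (f : M →ₗ[k] N),
      Equivariant ρM ρN f →
      (∀ g : N →ₗ[k] M, Equivariant ρN ρM g →
        StableIso ρM ρM (LinearMap.id - g ∘ₗ f)) →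
      (∀ g : N ⊗[k] X →ₗ[k] M ⊗[k] X,
        Equivariant (ρN.tprod ρX) (ρM.tprod ρX) g →
        StableIso (ρM.tprod ρX) (ρM.tprod ρX) (LinearMap.id - g ∘ₗ f.rTensor X))) ↔
    ¬ (p ^ 2 ∣ Fintype.card G) := by
  have : Fact p.Prime := ⟨hp⟩
  have hG₀ : (Fintype.card G : k) = 0 := (CharP.cast_eq_zero_iff k p _).2 hG
  constructor
  · intro H hpG
    classical
    obtain ⟨Q, hQ⟩ := exists_subgroup_card_eq hG
    have : Fintype (G ⧸ Q) := Fintype.ofFinite _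
    have hA : (Fintype.card (G ⧸ Q) : k) = 0 := by
      rw [← Nat.card_eq_fintype_card, Q.card_eq_card_quotient_mul_card_subgroup, hQ, pow_two] at hpG
      rw [CharP.cast_eq_zero_iff k p, ← Nat.card_eq_fintype_card]
      exact Nat.dvd_of_mul_dvd_mul_right hp.pos hpG
    have hst := H _ _ (G ⧸ Q → k) _ _ (funRep k G (G ⧸ Q)) (diagSum k (G ⧸ Q)) equivariant_diagSum
      (fun γ hγ ↦ stableIso_id_sub_comp_of_comp_eq_zero equivariant_diagSum hγ
        (diagSum_comp_eq_zero hA hγ)) _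
      ((equivariant_funCoev (A := G ⧸ Q)).comp (equivariant_lid _))
    obtain ⟨t, ht⟩ := exists_transfer_eq_id_of_stableIso
      ((equivariant_lid _).comp equivariant_diagSum.rTensor)
      (equivariant_funCoev (k := k) (G := G) (A := G ⧸ Q))
      lid_diagSum_funCoev (by rwa [← LinearMap.comp_assoc])
    refine transfer_funRep_quotient_ne_id ?_ t ht
    rw [← Nat.card_eq_fintype_card, hQ, CharP.cast_eq_zero]
  · intro hpG M N X _ _ _ _ _ _ _ _ _ ρM ρN ρX f hf hrad g hg
    have hneg (g : N →ₗ[k] M) (hg : Equivariant ρN ρM g) :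
        LinearMap.trace k M (g ∘ₗ f) = 0 :=
      trace_eq_zero_of_stableIso hG₀ (hg.comp hf) fun b hb ↦ by
        simpa only [LinearMap.comp_assoc] using hrad _ (hb.comp hg)
    refine stableIso_id_sub_of_trace
      (fun _ _ _ _ ρ htr ↦ exists_transfer_eq_id_of_sq_not_dvd hG hpG ρ htr)
      (hg.comp hf.rTensor) fun b hb ↦ ?_
    rw [← LinearMap.comp_assoc]
    exact trace_comp_rTensor_eq_zero hneg (hb.comp hg)
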